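/- Let V be a real vector space of finite dimension n ≥ 5, g a nondegenerate symmetric bilinear form on V, and O_g the group of linear automorphisms of V preserving g. Let N₃ be the space of 5-linear forms on V that are symmetric in the first two arguments, symmetric in the last three arguments, and whose cyclic sum over the last four arguments vanishes, and let Λ²V* be the space of alternating bilinear forms on V. Then every O_g-equivariant linear map N₃ ⊗ Λ²V* → V* ⊗ V* is the zero map. -/

import Mathlib

open TensorProduct

set_option synthInstance.maxHeartbeats 1000000
set_option maxHeartbeats 1000000

noncomputable section

/-- A 4-cycle of `Fin 5` fixing `0`, cycling the last four positions. -/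
def cyc4 : Equiv.Perm (Fin 5) := Equiv.swap 1 2 * Equiv.swap 2 3 * Equiv.swap 3 4

/-- The space `N₃` of normal tensors of order 3: 5-linear forms on `V` symmetric in the
first two arguments, symmetric in the last three arguments, and whose cyclic sum over the
last four arguments vanishes. -/
def N3 (V : Type*) [AddCommGroup V] [Module ℝ V] :
    Submodule ℝ (MultilinearMap ℝ (fun _ : Fin 5 => V) ℝ) where
  carrier := {T |
    (∀ v : Fin 5 → V, T (v ∘ Equiv.swap 0 1) = T v) ∧
    (∀ σ : Equiv.Perm (Fin 5), σ 0 = 0 → σ 1 = 1 → ∀ v : Fin 5 → V, T (v ∘ σ) = T v) ∧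
    (∀ v : Fin 5 → V,
      T v + T (v ∘ cyc4) + T (v ∘ (cyc4 * cyc4)) + T (v ∘ (cyc4 * cyc4 * cyc4)) = 0)}
  add_mem' := by
    rintro T S ⟨h1, h2, h3⟩ ⟨k1, k2, k3⟩
    refine ⟨fun v => ?_, fun σ hσ0 hσ1 v => ?_, fun v => ?_⟩ <;>
      simp only [MultilinearMap.add_apply]
    · rw [h1 v, k1 v]
    · rw [h2 σ hσ0 hσ1 v, k2 σ hσ0 hσ1 v]
    · linarith [h3 v, k3 v]
  zero_mem' := by
    refine ⟨fun v => ?_, fun σ hσ0 hσ1 v => ?_, fun v => ?_⟩ <;> simp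
  smul_mem' := by
    rintro r T ⟨h1, h2, h3⟩
    refine ⟨fun v => ?_, fun σ hσ0 hσ1 v => ?_, fun v => ?_⟩ <;>
      simp only [MultilinearMap.smul_apply, smul_eq_mul]
    · rw [h1 v]
    · rw [h2 σ hσ0 hσ1 v]
    · linear_combination r * h3 v

variable {V : Type*} [AddCommGroup V] [Module ℝ V]

/-- The action of a linear automorphism `A` of `V` on `k`-linear forms,
`(A • T)(v₁,...,v₅) = T(A⁻¹v₁,...,A⁻¹v₅)`. -/
def actM (A : V ≃ₗ[ℝ] V) (T : MultilinearMap ℝ (fun _ : Fin 5 => V) ℝ) :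
    MultilinearMap ℝ (fun _ : Fin 5 => V) ℝ :=
  T.compLinearMap fun _ => (A.symm : V →ₗ[ℝ] V)

lemma actM_mem_N3 (A : V ≃ₗ[ℝ] V) {T : MultilinearMap ℝ (fun _ : Fin 5 => V) ℝ}
    (hT : T ∈ N3 V) : actM A T ∈ N3 V := by
  obtain ⟨h1, h2, h3⟩ := hT
  refine ⟨fun v => ?_, fun σ hσ0 hσ1 v => ?_, fun v => ?_⟩ <;>
    simp only [actM, MultilinearMap.compLinearMap_apply]
  · exact h1 fun i => A.symm (v i)
  · exact h2 σ hσ0 hσ1 fun i => A.symm (v i)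
  · exact h3 fun i => A.symm (v i)

/-- The element of `N₃` obtained by acting with `A`. -/
def actN3 (A : V ≃ₗ[ℝ] V) (T : N3 V) : N3 V := ⟨actM A (T : _), actM_mem_N3 A T.2⟩

/-- The action of `A` on alternating bilinear forms. -/
def actΛ (A : V ≃ₗ[ℝ] V) (F : V [⋀^Fin 2]→ₗ[ℝ] ℝ) : V [⋀^Fin 2]→ₗ[ℝ] ℝ :=
  F.compLinearMap (A.symm : V →ₗ[ℝ] V)

/-- The action of `A` on the dual space, `(A • ξ)(v) = ξ(A⁻¹v)`. -/
def actDual (A : V ≃ₗ[ℝ] V) : Module.Dual ℝ V →ₗ[ℝ] Module.Dual ℝ V :=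
  LinearMap.dualMap (A.symm : V →ₗ[ℝ] V)

/-- for `dim V = n ≥ 5` and `g` a nondegenerate symmetric bilinear form,
every `O_g`-equivariant linear map `N₃ ⊗ Λ²V* → V* ⊗ V*` is zero. -/
theorem equivariant_maps_N3_tensor_Lambda2_eq_zero
    (n : ℕ) (hn : 5 ≤ n)
    {V : Type*} [AddCommGroup V] [Module ℝ V] [FiniteDimensional ℝ V]
    (hdim : Module.finrank ℝ V = n)
    (g : V →ₗ[ℝ] V →ₗ[ℝ] ℝ)
    (hsym : ∀ u v : V, g u v = g v u)
    (hnondeg : ∀ u : V, (∀ v : V, g u v = 0) → u = 0)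
    (Φ : (N3 V ⊗[ℝ] (V [⋀^Fin 2]→ₗ[ℝ] ℝ)) →ₗ[ℝ] (Module.Dual ℝ V ⊗[ℝ] Module.Dual ℝ V))
    (hequiv : ∀ A : V ≃ₗ[ℝ] V, (∀ u v : V, g (A u) (A v) = g u v) →
      ∀ (T : N3 V) (F : V [⋀^Fin 2]→ₗ[ℝ] ℝ),
        Φ (actN3 A T ⊗ₜ[ℝ] actΛ A F) =
          TensorProduct.map (actDual A) (actDual A) (Φ (T ⊗ₜ[ℝ] F))) :
    Φ = 0 := by
  have hN : ∀ T : N3 V, actN3 (LinearEquiv.neg ℝ) T = (-1 : ℝ) • T := by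
    intro T
    apply Subtype.ext
    ext v
    change (T : MultilinearMap ℝ (fun _ : Fin 5 => V) ℝ) (fun i => -(v i)) = (-1 : ℝ) * (T.1 v)
    have h := MultilinearMap.map_smul_univ T.1 (fun _ => (-1 : ℝ)) v
    simp only [neg_smul, one_smul, Finset.prod_const, Finset.card_univ, Fintype.card_fin,
      smul_eq_mul] at h
    rw [h]
    norm_num
  have hL : ∀ F : V [⋀^Fin 2]→ₗ[ℝ] ℝ, actΛ (LinearEquiv.neg ℝ) F = F := by
    intro F
    ext v
    change F.toMultilinearMap (fun i => -(v i)) = F.toMultilinearMap v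
    have h := MultilinearMap.map_smul_univ F.toMultilinearMap (fun _ => (-1 : ℝ)) v
    simp only [neg_smul, one_smul, Finset.prod_const, Finset.card_univ, Fintype.card_fin,
      smul_eq_mul] at h
    rw [h]
    norm_num
  have hD : TensorProduct.map (actDual (V := V) (LinearEquiv.neg ℝ))
      (actDual (V := V) (LinearEquiv.neg ℝ)) = LinearMap.id := by
    have hd : ∀ x : Module.Dual ℝ V, actDual (V := V) (LinearEquiv.neg ℝ) x = (-1 : ℝ) • x := by
      intro x
      ext v
      change x (-v) = (-1 : ℝ) * (x v)
      rw [map_neg, neg_one_mul]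
    apply TensorProduct.ext'
    intro x y
    rw [TensorProduct.map_tmul, hd, hd, TensorProduct.smul_tmul_smul, neg_one_mul, neg_neg, one_smul]
    rfl
  apply TensorProduct.ext'
  intro T F
  have h := hequiv (LinearEquiv.neg ℝ) (by intro u v; simp) T F
  rw [hN, hL, hD, ← TensorProduct.smul_tmul', map_smul, LinearMap.id_apply] at h
  rw [LinearMap.zero_apply]
  have h2 : (2 : ℝ) • Φ (T ⊗ₜ[ℝ] F) = 0 := by
    have e : (2 : ℝ) • Φ (T ⊗ₜ[ℝ] F) = Φ (T ⊗ₜ[ℝ] F) + Φ (T ⊗ₜ[ℝ] F) := two_smul _ _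
    rw [e]
    nth_rewrite 1 [← h]
    nth_rewrite 2 [← one_smul ℝ (Φ (T ⊗ₜ[ℝ] F))]
    rw [← add_smul, neg_add_cancel, zero_smul]
  exact (smul_eq_zero.mp h2).resolve_left two_ne_zero
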